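/- arXiv:1911.09482 — 4 statements merged into one kernel-verified Lean document; each statement's English description precedes it below -/
import Mathlib

section
/- Let X be a real Banach space, let U ⊆ X be an open set and let T : U → X be a continuous map. Assume: (1) there is a nonempty subset F ⊆ U which is closed in X and satisfies T(F) ⊆ F; (2) there exists k ∈ (0,1) such that for every x ∈ U with T(x) ∈ U one has ‖T(T(x)) − T(x)‖ ≤ k·‖T(x) − x‖. Then there exists an open set V with F ⊆ V ⊆ U and Fix(T) ⊆ V and T(V) ⊆ V, and a map θ : V → X, such that for every x ∈ V: all iterates T^p(x) (p ∈ ℕ) are defined and lie in V, the sequence (T^p(x))_p converges in norm to θ(x), θ(x) ∈ V, T(θ(x)) = θ(x), and for every p ∈ ℕ one has ‖θ(x) − T^p(x)‖ ≤ (k^p/(1−k))·‖T(x) − x‖. In particular θ(x) = x for every x ∈ Fix(T) (so θ is a retraction of V onto Fix(T) ∩ V), and θ(F) ⊆ F ∩ Fix(T). -/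
lemma sere_conv {X : Type*} [NormedAddCommGroup X] [CompleteSpace X]
    (U : Set X) (T : X → X) (k : ℝ) (hk0 : 0 < k) (hk1 : k < 1)
    (hcontr : ∀ x ∈ U, T x ∈ U → ‖T (T x) - T x‖ ≤ k * ‖T x - x‖)
    (x : X) (hx : ∀ p : ℕ, T^[p] x ∈ U) :
    ∃ l, Filter.Tendsto (fun p : ℕ => T^[p] x) Filter.atTop (nhds l) ∧
      ∀ p : ℕ, ‖l - T^[p] x‖ ≤ k ^ p / (1 - k) * ‖T x - x‖ := by
  have hstep : ∀ p : ℕ, dist (T^[p] x) (T^[p+1] x) ≤ ‖T x - x‖ * k ^ p := by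
    intro p
    induction p with
    | zero => simp [dist_eq_norm, norm_sub_rev]
    | succ p ih =>
      have h1 := hx (p+1)
      rw [Function.iterate_succ_apply'] at h1
      have h2 := hcontr _ (hx p) h1
      rw [dist_comm, dist_eq_norm, Function.iterate_succ_apply'] at ih
      rw [dist_comm, dist_eq_norm, Function.iterate_succ_apply', Function.iterate_succ_apply']
      calc _ ≤ _ := h2
        _ ≤ k * (‖T x - x‖ * k ^ p) := by gcongr
        _ = _ := by ring
  obtain ⟨l, hl⟩ := cauchySeq_tendsto_of_complete (cauchySeq_of_le_geometric k _ hk1 hstep)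
  refine ⟨l, hl, fun p => ?_⟩
  have h := dist_le_of_le_geometric_of_tendsto k _ hk1 hstep hl p
  rw [dist_comm, dist_eq_norm] at h
  calc _ ≤ _ := h
    _ = _ := by ring

lemma sere_fix {X : Type*} [NormedAddCommGroup X]
    (U : Set X) (hU : IsOpen U) (T : X → X) (hTcont : ContinuousOn T U)
    (x l : X) (hl : Filter.Tendsto (fun p : ℕ => T^[p] x) Filter.atTop (nhds l)) (hlU : l ∈ U) :
    T l = l := by
  have h1 := ((hTcont.continuousAt (hU.mem_nhds hlU)).tendsto).comp hl
  have h2 := hl.comp (Filter.tendsto_add_atTop_nat 1)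
  refine tendsto_nhds_unique h1 (h2.congr fun p => ?_)
  simp [Function.iterate_succ_apply']

/-- The basic basin: points where the a priori estimate keeps the orbit in `U`. -/
def sereO {X : Type*} [NormedAddCommGroup X] (U : Set X) (T : X → X) (k : ℝ) : Set X :=
  {x | ∃ r : ℝ, Metric.ball x r ⊆ U ∧ ‖T x - x‖ < (1 - k) * r}

/-- Iterated preimages of the basin. -/
def sereV {X : Type*} [NormedAddCommGroup X] (U : Set X) (T : X → X) (k : ℝ) : ℕ → Set X
  | 0 => sereO U T k
  | n + 1 => U ∩ T ⁻¹' (sereV U T k n)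

lemma sereO_pos {k r d : ℝ} (hk1 : k < 1) (hd : 0 ≤ d) (h : d < (1 - k) * r) : 0 < r := by
  by_contra hr
  nlinarith

lemma sereO_sub {X : Type*} [NormedAddCommGroup X] (U : Set X) (T : X → X) (k : ℝ)
    (hk1 : k < 1) : sereO U T k ⊆ U := by
  rintro x ⟨r, hr, h⟩
  exact hr (Metric.mem_ball_self (sereO_pos hk1 (norm_nonneg _) h))

lemma sereO_maps {X : Type*} [NormedAddCommGroup X] (U : Set X) (T : X → X) (k : ℝ)
    (hk0 : 0 < k) (hk1 : k < 1)
    (hcontr : ∀ x ∈ U, T x ∈ U → ‖T (T x) - T x‖ ≤ k * ‖T x - x‖) :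
    Set.MapsTo T (sereO U T k) (sereO U T k) := by
  intro x hx
  have hxU := sereO_sub U T k hk1 hx
  obtain ⟨r, hr, h⟩ := hx
  have hr0 := sereO_pos hk1 (norm_nonneg _) h
  have hTx : T x ∈ U := by
    apply hr
    rw [Metric.mem_ball, dist_eq_norm]
    nlinarith
  refine ⟨r - ‖T x - x‖, (Metric.ball_subset_ball' ?_).trans hr, ?_⟩
  · rw [dist_eq_norm]; linarith
  · have := hcontr x hxU hTx
    linarith

lemma sereO_open {X : Type*} [NormedAddCommGroup X]
    (U : Set X) (hU : IsOpen U) (T : X → X) (hTcont : ContinuousOn T U) (k : ℝ)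
    (hk1 : k < 1) : IsOpen (sereO U T k) := by
  rw [isOpen_iff_mem_nhds]
  intro x hx
  have hxU := sereO_sub U T k hk1 hx
  obtain ⟨r, hr, h⟩ := hx
  have hc : ContinuousAt T x := hTcont.continuousAt (hU.mem_nhds hxU)
  have h1 : ContinuousAt (fun y => ‖T y - y‖) x := (hc.sub continuousAt_id).norm
  have h2 : ContinuousAt (fun y => (1 - k) * (r - dist y x)) x := by fun_prop
  have h3 := h1.eventually_lt h2 (by simpa using h)
  filter_upwards [h3] with y hy
  exact ⟨r - dist y x, (Metric.ball_subset_ball' (by linarith)).trans hr, hy⟩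

lemma sereO_fix {X : Type*} [NormedAddCommGroup X]
    (U : Set X) (hU : IsOpen U) (T : X → X) (k : ℝ)
    (hk1 : k < 1) (x : X) (hx : x ∈ U) (h : T x = x) : x ∈ sereO U T k := by
  obtain ⟨r, hr0, hr⟩ := Metric.isOpen_iff.1 hU x hx
  refine ⟨r, hr, ?_⟩
  rw [h, sub_self, norm_zero]
  exact mul_pos (by linarith) hr0

/-- **Séré's retraction theorem (Theorem `theo_theta` in the paper).**
Let `X` be a real Banach space, `U ⊆ X` open and `T : U → X` continuous (modelled as a
total map `T : X → X` that is continuous on `U`). Assume `F ⊆ U` is nonempty, closed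
in `X` and `T`-invariant, and that there is `k ∈ (0,1)` with
`‖T² x − T x‖ ≤ k‖T x − x‖` for all `x ∈ U` with `T x ∈ U`. Then there is an open
neighborhood `V` of `F` with `Fix(T) ⊆ V ⊆ U`, `T(V) ⊆ V`, and a retraction
`θ : V → Fix(T)`: for every `x ∈ V` all iterates `T^[p] x` stay in `V` and converge in
norm to `θ x ∈ V`, a fixed point of `T`, with
`‖θ x − T^[p] x‖ ≤ k^p/(1−k) · ‖T x − x‖`; moreover `θ` fixes every fixed point of `T`
and maps `F` into `F ∩ Fix(T)`. -/
theorem sere_retraction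
    {X : Type*} [NormedAddCommGroup X] [NormedSpace ℝ X] [CompleteSpace X]
    (U : Set X) (hU : IsOpen U)
    (T : X → X) (hTcont : ContinuousOn T U)
    (F : Set X) (hFne : F.Nonempty) (hFU : F ⊆ U) (hFclosed : IsClosed F)
    (hTF : Set.MapsTo T F F)
    (k : ℝ) (hk0 : 0 < k) (hk1 : k < 1)
    (hcontr : ∀ x ∈ U, T x ∈ U → ‖T (T x) - T x‖ ≤ k * ‖T x - x‖) :
    ∃ (V : Set X) (θ : X → X),
      IsOpen V ∧ F ⊆ V ∧ V ⊆ U ∧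
      {x ∈ U | T x = x} ⊆ V ∧
      Set.MapsTo T V V ∧
      (∀ x ∈ V,
        (∀ p : ℕ, T^[p] x ∈ V) ∧
        Filter.Tendsto (fun p : ℕ => T^[p] x) Filter.atTop (nhds (θ x)) ∧
        θ x ∈ V ∧
        T (θ x) = θ x ∧
        (∀ p : ℕ, ‖θ x - T^[p] x‖ ≤ k ^ p / (1 - k) * ‖T x - x‖)) ∧
      (∀ x ∈ U, T x = x → θ x = x) ∧
      (∀ x ∈ F, θ x ∈ F ∧ T (θ x) = θ x) := by
  have hOU := sereO_sub U T k hk1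
  have hOm := sereO_maps U T k hk0 hk1 hcontr
  have hOo := sereO_open U hU T hTcont k hk1
  have hOf := sereO_fix U hU T k hk1
  have hVo : ∀ n, IsOpen (sereV U T k n) := by
    intro n
    induction n with
    | zero => exact hOo
    | succ n ih => exact hTcont.isOpen_inter_preimage hU ih
  have hVU : ∀ n, sereV U T k n ⊆ U := by
    intro n
    cases n with
    | zero => exact hOU
    | succ n => exact Set.inter_subset_left
  have hOV : sereO U T k ⊆ ⋃ n, sereV U T k n :=
    fun x hx => Set.mem_iUnion.2 ⟨0, hx⟩
  have hVm : Set.MapsTo T (⋃ n, sereV U T k n) (⋃ n, sereV U T k n) := by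
    intro x hx
    obtain ⟨n, hn⟩ := Set.mem_iUnion.1 hx
    cases n with
    | zero => exact hOV (hOm hn)
    | succ n => exact Set.mem_iUnion.2 ⟨n, hn.2⟩
  have hVU' : (⋃ n, sereV U T k n) ⊆ U := Set.iUnion_subset hVU
  have hback : ∀ n, ∀ x, (∀ p, T^[p] x ∈ U) → T^[n] x ∈ sereO U T k → x ∈ sereV U T k n := by
    intro n
    induction n with
    | zero => exact fun x _ h => h
    | succ n ih =>
      intro x hx h
      exact ⟨hx 0, ih (T x) (fun p => hx (p+1)) h⟩
  have hforw : ∀ n, ∀ x, x ∈ sereV U T k n → T^[n] x ∈ sereO U T k := by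
    intro n
    induction n with
    | zero => exact fun x h => h
    | succ n ih => exact fun x h => ih (T x) h.2
  have hOlim : ∀ x ∈ sereO U T k, ∀ l,
      Filter.Tendsto (fun p : ℕ => T^[p] x) Filter.atTop (nhds l) → l ∈ U := by
    intro x hx l hl
    obtain ⟨l', hl', hb⟩ := sere_conv U T k hk0 hk1 hcontr x
      (fun p => hOU (hOm.iterate p hx))
    obtain rfl := tendsto_nhds_unique hl hl'
    obtain ⟨r, hr, h⟩ := hx
    apply hr
    rw [Metric.mem_ball, dist_eq_norm]
    have hb0 := hb 0
    have hk : 0 < 1 - k := by linarith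
    simp only [Function.iterate_zero, id, pow_zero] at hb0
    refine hb0.trans_lt ?_
    rw [one_div, inv_mul_lt_iff₀ hk]
    exact h
  have hFit : ∀ x ∈ F, ∀ p, T^[p] x ∈ F := fun x hx p => hTF.iterate p hx
  have hFV : F ⊆ ⋃ n, sereV U T k n := by
    intro x hx
    have hxU : ∀ p, T^[p] x ∈ U := fun p => hFU (hFit x hx p)
    obtain ⟨l, hl, -⟩ := sere_conv U T k hk0 hk1 hcontr x hxU
    have hlF : l ∈ F := hFclosed.mem_of_tendsto hl (Filter.Eventually.of_forall (hFit x hx))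
    have hlO := hOf l (hFU hlF) (sere_fix U hU T hTcont x l hl (hFU hlF))
    obtain ⟨n, hn⟩ := (hl.eventually (hOo.mem_nhds hlO)).exists
    exact Set.mem_iUnion.2 ⟨n, hback n x hxU hn⟩
  have hmain : ∀ x ∈ ⋃ n, sereV U T k n, ∃ l,
      Filter.Tendsto (fun p : ℕ => T^[p] x) Filter.atTop (nhds l) ∧ l ∈ U ∧ T l = l ∧
      ∀ p : ℕ, ‖l - T^[p] x‖ ≤ k ^ p / (1 - k) * ‖T x - x‖ := by
    intro x hx
    obtain ⟨l, hl, hb⟩ := sere_conv U T k hk0 hk1 hcontr x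
      (fun p => hVU' (hVm.iterate p hx))
    obtain ⟨n, hn⟩ := Set.mem_iUnion.1 hx
    have hlU : l ∈ U := by
      refine hOlim _ (hforw n x hn) l ?_
      refine (hl.comp (Filter.tendsto_add_atTop_nat n)).congr fun p => ?_
      simp [Function.iterate_add_apply]
    exact ⟨l, hl, hlU, sere_fix U hU T hTcont x l hl hlU, hb⟩
  have hθ : ∀ x : X, ∃ l, x ∈ (⋃ n, sereV U T k n) →
      (Filter.Tendsto (fun p : ℕ => T^[p] x) Filter.atTop (nhds l) ∧ l ∈ U ∧ T l = l ∧
      ∀ p : ℕ, ‖l - T^[p] x‖ ≤ k ^ p / (1 - k) * ‖T x - x‖) := by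
    intro x
    by_cases hx : x ∈ ⋃ n, sereV U T k n
    · obtain ⟨l, h⟩ := hmain x hx
      exact ⟨l, fun _ => h⟩
    · exact ⟨x, fun h => absurd h hx⟩
  choose θ hθ using hθ
  refine ⟨⋃ n, sereV U T k n, θ, isOpen_iUnion hVo, hFV, hVU',
    fun x hx => hOV (hOf x hx.1 hx.2), hVm, ?_, ?_, ?_⟩
  · intro x hx
    obtain ⟨h1, h2, h3, h4⟩ := hθ x hx
    exact ⟨fun p => hVm.iterate p hx, h1, hOV (hOf _ h2 h3), h3, h4⟩
  · intro x hx h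
    obtain ⟨h1, -⟩ := hθ x (hOV (hOf x hx h))
    refine tendsto_nhds_unique h1 (tendsto_const_nhds.congr fun p => ?_)
    exact (Function.iterate_fixed h p).symm
  · intro x hx
    obtain ⟨h1, -, h3, -⟩ := hθ x (hFV hx)
    exact ⟨hFclosed.mem_of_tendsto h1 (Filter.Eventually.of_forall (hFit x hx)), h3⟩
end

section
/- Let H be a complex Hilbert space and let A, B be bounded linear operators on H, with A self-adjoint and invertible, and B self-adjoint and nonnegative with nonnegative square root √B. Let λ_c denote the infimum of the (real) spectrum of the self-adjoint operator √B·A⁻¹·√B. Then for every real ν ≥ 0 satisfying ν·λ_c > −1 (in particular, for every ν ≥ 0 when λ_c ≥ 0, and for every 0 ≤ ν < −1/λ_c when λ_c < 0), the operator A + ν·B is invertible. -/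
/-- **Critical coupling constant via the Birman–Schwinger operator (Corollary
`cor:critical_nu`, first part).** Let `A` be a self-adjoint invertible bounded operator
and `B` a nonnegative self-adjoint bounded operator on a complex Hilbert space, with
nonnegative square root `S = √B`. Let `λc` be the infimum of the real spectrum of the
self-adjoint operator `√B·A⁻¹·√B`. Then for every `ν ≥ 0` with `ν·λc > −1`
(in particular all `ν ≥ 0` if `λc ≥ 0`, and all `0 ≤ ν < −1/λc` if `λc < 0`),
the operator `A + ν·B` is invertible. -/
theorem critical_coupling_invertible
    {H : Type*} [NormedAddCommGroup H] [InnerProductSpace ℂ H] [CompleteSpace H]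
    (A B S : H →L[ℂ] H)
    (hA : IsSelfAdjoint A) (hAu : IsUnit A)
    (hB : B.IsPositive)
    (hS : S.IsPositive) (hS2 : S * S = B)
    (lc : ℝ) (hlc : lc = sInf (spectrum ℝ (S * Ring.inverse A * S))) :
    ∀ ν : ℝ, 0 ≤ ν → ν * lc > -1 → IsUnit (A + ν • B) := by
  intro ν hν hlt
  rcases hν.eq_or_lt with rfl | hpos
  · simpa using hAu
  have hne : -ν⁻¹ ≠ 0 := neg_ne_zero.mpr (inv_ne_zero hpos.ne')
  have hnot : -ν⁻¹ ∉ spectrum ℝ (S * (Ring.inverse A * S)) := by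
    intro hmem
    rw [← mul_assoc] at hmem
    have hle : lc ≤ -ν⁻¹ := by
      rw [hlc]
      exact csInf_le (spectrum.isCompact (𝕜 := ℝ) _).bddBelow hmem
    have h1 := mul_le_mul_of_nonneg_left hle hν
    have h2 : ν * -ν⁻¹ = -1 := by field_simp
    linarith
  have hnot2 : -ν⁻¹ ∉ spectrum ℝ ((Ring.inverse A * S) * S) := by
    intro hmem
    exact hnot ((spectrum.unit_mem_mul_comm (r := Units.mk0 _ hne)).mp hmem)
  rw [spectrum.notMem_iff] at hnot2
  have key : A + ν • B =
      A * ((algebraMap ℝ (H →L[ℂ] H) (-ν)) *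
        (algebraMap ℝ (H →L[ℂ] H) (-ν⁻¹) - (Ring.inverse A * S) * S)) := by
    have h3 : (-ν) * (-ν⁻¹) = 1 := by field_simp
    rw [mul_sub, ← map_mul, h3, map_one, mul_sub, mul_one, ← Algebra.smul_def, mul_smul_comm,
      mul_assoc (Ring.inverse A), ← mul_assoc A, Ring.mul_inverse_cancel _ hAu, one_mul, hS2,
      neg_smul, sub_neg_eq_add]
  rw [key]
  exact hAu.mul (((neg_ne_zero.mpr hpos.ne').isUnit.map (algebraMap ℝ (H →L[ℂ] H))).mul hnot2)
end

section
/- Let H be a complex Hilbert space and let A, B be bounded linear operators on H, with A self-adjoint and invertible, and B self-adjoint and nonnegative with nonnegative square root √B. Let λ_c denote the infimum of the (real) spectrum of the self-adjoint operator √B·A⁻¹·√B, and assume λ_c < 0. Then, setting ν₀ = −1/λ_c, the operator A + ν₀·B is NOT invertible. -/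
/-- **Criticality at the threshold coupling (Corollary `cor:critical_nu`, second
part).** Let `A` be a self-adjoint invertible bounded operator and `B` a nonnegative
self-adjoint bounded operator on a complex Hilbert space, with nonnegative square root
`S = √B`. Let `λc` be the infimum of the real spectrum of the self-adjoint operator
`√B·A⁻¹·√B` and assume `λc < 0`. Then, with `ν₀ = −1/λc`, the operator `A + ν₀·B`
is NOT invertible. -/
theorem critical_coupling_not_invertible
    {H : Type*} [NormedAddCommGroup H] [InnerProductSpace ℂ H] [CompleteSpace H]
    (A B S : H →L[ℂ] H)
    (hA : IsSelfAdjoint A) (hAu : IsUnit A)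
    (hB : B.IsPositive)
    (hS : S.IsPositive) (hS2 : S * S = B)
    (lc : ℝ) (hlc : lc = sInf (spectrum ℝ (S * Ring.inverse A * S)))
    (hlcneg : lc < 0) :
    ¬ IsUnit (A + (-1 / lc) • B) := by
  intro hU
  have hne : (spectrum ℝ (S * Ring.inverse A * S)).Nonempty := by
    by_contra h
    rw [Set.not_nonempty_iff_eq_empty] at h
    rw [h, Real.sInf_empty] at hlc
    exact hlcneg.ne hlc
  have hmem : lc ∈ spectrum ℝ (S * Ring.inverse A * S) := by
    rw [hlc]
    exact (spectrum.isCompact (𝕜 := ℝ) (S * Ring.inverse A * S)).sInf_mem hne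
  have hne0 : lc ≠ 0 := hlcneg.ne
  have hmem2 : lc ∈ spectrum ℝ (S * (S * Ring.inverse A)) \ {0} := by
    rw [← spectrum.nonzero_mul_comm]
    exact ⟨hmem, hne0⟩
  have h3 := hmem2.1
  rw [spectrum.mem_iff] at h3
  apply h3
  have e : algebraMap ℝ (H →L[ℂ] H) lc - S * (S * Ring.inverse A)
      = algebraMap ℝ (H →L[ℂ] H) lc * ((A + (-1 / lc) • B) * Ring.inverse A) := by
    rw [add_mul, Ring.mul_inverse_cancel A hAu, mul_add, mul_one, ← mul_assoc S S, hS2,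
      ← Algebra.smul_def, smul_mul_assoc, smul_smul, mul_div_cancel₀ _ hne0, neg_one_smul,
      sub_eq_add_neg]
  rw [e]
  exact ((IsUnit.mk0 lc hne0).map (algebraMap ℝ (H →L[ℂ] H))).mul (hU.mul hAu.ringInverse)
end

section
/- Let ρ be a finite signed Borel measure on ℝ³ with total variation measure |ρ|, and let V(x) = ∫_{ℝ³} ‖x − y‖⁻¹ dρ(y) (which is well defined for almost every x ∈ ℝ³). Then for every Schwartz function Ψ : ℝ³ → ℂ⁴ one has the L² bound (∫_{ℝ³} ‖(D₀Ψ)(x) + V(x)·Ψ(x)‖²_{ℂ⁴} dx)^{1/2} ≤ (1 + 2·|ρ|(ℝ³)) · (∫_{ℝ³} ‖(D₀Ψ)(x)‖²_{ℂ⁴} dx)^{1/2}. -/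
noncomputable section
open MeasureTheory

/-- Physical space `ℝ³`. -/
abbrev Space := EuclideanSpace ℝ (Fin 3)

/-- Spinor space `ℂ⁴` with its Euclidean (ℓ²) norm. -/
abbrev Spinor := EuclideanSpace ℂ (Fin 4)

/-- The Pauli matrices `σ₁, σ₂, σ₃`. -/
def pauli : Fin 3 → Matrix (Fin 2) (Fin 2) ℂ
  | 0 => !![0, 1; 1, 0]
  | 1 => !![0, -Complex.I; Complex.I, 0]
  | 2 => !![1, 0; 0, -1]

/-- The Dirac matrices `α_k = [[0, σ_k], [σ_k, 0]]` in `2×2` block form. -/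
def diracAlpha (k : Fin 3) : Matrix (Fin 4) (Fin 4) ℂ :=
  Matrix.reindex finSumFinEquiv finSumFinEquiv
    (Matrix.fromBlocks 0 (pauli k) (pauli k) 0)

/-- The Dirac matrix `β = [[I₂, 0], [0, −I₂]]` in `2×2` block form. -/
def diracBeta : Matrix (Fin 4) (Fin 4) ℂ :=
  Matrix.reindex finSumFinEquiv finSumFinEquiv
    (Matrix.fromBlocks (1 : Matrix (Fin 2) (Fin 2) ℂ) 0 0
      (-1 : Matrix (Fin 2) (Fin 2) ℂ))

/-- Action of a `4×4` complex matrix on a spinor. -/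
def matVec (A : Matrix (Fin 4) (Fin 4) ℂ) (v : Spinor) : Spinor :=
  (WithLp.equiv 2 (Fin 4 → ℂ)).symm (A.mulVec ((WithLp.equiv 2 (Fin 4 → ℂ)) v))

/-- The partial derivative `∂_k Ψ` of a Schwartz function `Ψ : ℝ³ → ℂ⁴`,
evaluated at `x`. -/
def partialDer (Ψ : SchwartzMap Space Spinor) (k : Fin 3) (x : Space) : Spinor :=
  fderiv ℝ Ψ x (EuclideanSpace.single k 1)

/-- The free Dirac operator: `(D₀Ψ)(x) = −i·Σ_k α_k (∂_k Ψ)(x) + β·Ψ(x)`. -/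
def diracOp (Ψ : SchwartzMap Space Spinor) (x : Space) : Spinor :=
  (-Complex.I) • (∑ k : Fin 3, matVec (diracAlpha k) (partialDer Ψ k x)) +
    matVec diracBeta (Ψ x)

/-- The Coulomb potential `V(x) = ∫ ‖x−y‖⁻¹ dρ(y)` generated by a finite signed
Borel measure `ρ` on `ℝ³`, computed via its Jordan decomposition. -/
def coulombPotential (ρ : SignedMeasure Space) (x : Space) : ℝ :=
  (∫ y, ‖x - y‖⁻¹ ∂ρ.toJordanDecomposition.posPart) -
    (∫ y, ‖x - y‖⁻¹ ∂ρ.toJordanDecomposition.negPart)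


open scoped FourierTransform LineDeriv SchwartzMap

/-- `matVec` as a continuous linear map. -/
def matCLM (A : Matrix (Fin 4) (Fin 4) ℂ) : Spinor →L[ℂ] Spinor :=
  LinearMap.toContinuousLinearMap
    { toFun := matVec A
      map_add' := by
        intro x y
        simp [matVec, Matrix.mulVec_add]
      map_smul' := by
        intro c x
        simp [matVec, Matrix.mulVec_smul] }

theorem matCLM_apply (A : Matrix (Fin 4) (Fin 4) ℂ) (v : Spinor) : matCLM A v = matVec A v := rfl

theorem dirac_symbol (t : Fin 3 → ℝ) (v : Spinor) :
    ‖(∑ k : Fin 3, (t k : ℂ) • matVec (diracAlpha k) v) + matVec diracBeta v‖ ^ 2 =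
      ((∑ k : Fin 3, t k ^ 2) + 1) * ‖v‖ ^ 2 := by
  have hα : ∀ k, diracAlpha k = !![0, 0, pauli k 0 0, pauli k 0 1; 0, 0, pauli k 1 0, pauli k 1 1;
      pauli k 0 0, pauli k 0 1, 0, 0; pauli k 1 0, pauli k 1 1, 0, 0] := by
    intro k
    ext i j
    fin_cases i <;> fin_cases j <;> rfl
  have hβ' : diracBeta = !![(1 : Matrix (Fin 2) (Fin 2) ℂ) 0 0, (1 : Matrix (Fin 2) (Fin 2) ℂ) 0 1, 0, 0;
      (1 : Matrix (Fin 2) (Fin 2) ℂ) 1 0, (1 : Matrix (Fin 2) (Fin 2) ℂ) 1 1, 0, 0;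
      0, 0, (-1 : Matrix (Fin 2) (Fin 2) ℂ) 0 0, (-1 : Matrix (Fin 2) (Fin 2) ℂ) 0 1;
      0, 0, (-1 : Matrix (Fin 2) (Fin 2) ℂ) 1 0, (-1 : Matrix (Fin 2) (Fin 2) ℂ) 1 1] := by
    ext i j
    fin_cases i <;> fin_cases j <;> rfl
  have hβ : diracBeta = !![1, 0, 0, 0; 0, 1, 0, 0; 0, 0, -1, 0; 0, 0, 0, -1] := by
    rw [hβ']
    simp
  simp only [EuclideanSpace.norm_sq_eq, Fin.sum_univ_four, Fin.sum_univ_three, hα, hβ, matVec, pauli]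
  simp [dotProduct, Fin.sum_univ_four, ← Complex.normSq_eq_norm_sq, Complex.normSq_apply]
  ring

theorem fourier_postcomp (L : Spinor →L[ℂ] Spinor) (f : 𝓢(Space, Spinor)) (ξ : Space) :
    𝓕 (f.postcompCLM L) ξ = L (𝓕 f ξ) := by
  rw [SchwartzMap.fourier_coe, SchwartzMap.fourier_coe, Real.fourier_eq, Real.fourier_eq,
    ← ContinuousLinearMap.integral_comp_comm]
  · simp
  · exact (Real.fourierIntegral_convergent_iff ξ).2 f.integrable

theorem fourier_partial (f : 𝓢(Space, Spinor)) (k : Fin 3) (ξ : Space) :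
    𝓕 (∂_{(EuclideanSpace.single k 1 : Space)} f) ξ =
      (2 * Real.pi * Complex.I * (ξ k : ℂ)) • 𝓕 f ξ := by
  rw [SchwartzMap.fourier_lineDerivOp_eq]
  have : (inner ℝ · (EuclideanSpace.single k 1 : Space)).HasTemperateGrowth :=
    ((innerSL ℝ).flip _).hasTemperateGrowth
  simp only [smul_apply, SchwartzMap.smulLeftCLM_apply_apply this]
  rw [EuclideanSpace.inner_single_right, mul_smul _ (ξ k : ℂ), Complex.coe_smul]
  simp

/-- The Dirac operator as Schwartz function. -/
def diracS (Ψ : 𝓢(Space, Spinor)) : 𝓢(Space, Spinor) :=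
  (-Complex.I) • (∑ k : Fin 3,
    (∂_{(EuclideanSpace.single k 1 : Space)} Ψ).postcompCLM (matCLM (diracAlpha k))) +
    Ψ.postcompCLM (matCLM diracBeta)

def partS (Ψ : 𝓢(Space, Spinor)) (k : Fin 3) : 𝓢(Space, Spinor) :=
  ∂_{(EuclideanSpace.single k 1 : Space)} Ψ

theorem diracS_apply (Ψ : 𝓢(Space, Spinor)) (x : Space) : diracS Ψ x = diracOp Ψ x := by
  simp [diracS, diracOp, Fin.sum_univ_three, matCLM_apply, SchwartzMap.lineDerivOp_apply_eq_fderiv, partialDer]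

theorem sch_sq_integrable (f : 𝓢(Space, Spinor)) : Integrable (fun x => ‖f x‖ ^ 2) := by
  have := (f.memLp 2 (volume : Measure Space))
  exact this.integrable_norm_pow (by norm_num)

theorem grad_le_dirac (Ψ : 𝓢(Space, Spinor)) :
    ∑ k : Fin 3, ∫ x, ‖partialDer Ψ k x‖ ^ 2 ≤ ∫ x, ‖diracOp Ψ x‖ ^ 2 := by
  have h1 : ∀ k, ∫ x, ‖partialDer Ψ k x‖ ^ 2 = ∫ ξ, ‖𝓕 (partS Ψ k) ξ‖ ^ 2 := by
    intro k
    rw [SchwartzMap.integral_norm_sq_fourier]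
    rfl
  have h2 : ∫ x, ‖diracOp Ψ x‖ ^ 2 = ∫ ξ, ‖𝓕 (diracS Ψ) ξ‖ ^ 2 := by
    rw [SchwartzMap.integral_norm_sq_fourier]
    simp only [diracS_apply]
  simp only [h1, h2]
  rw [← integral_finsetSum _ (fun k _ => sch_sq_integrable _)]
  refine integral_mono (integrable_finsetSum _ (fun k _ => sch_sq_integrable _))
    (sch_sq_integrable _) fun ξ => ?_
  have h3 : 𝓕 (diracS Ψ) ξ = (∑ k : Fin 3, ((2 * Real.pi * ξ k : ℝ) : ℂ) •
      matVec (diracAlpha k) (𝓕 Ψ ξ)) + matVec diracBeta (𝓕 Ψ ξ) := by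
    rw [diracS, FourierTransform.fourier_add, FourierTransform.fourier_smul, Fin.sum_univ_three, FourierTransform.fourier_add, FourierTransform.fourier_add]
    simp only [add_apply, smul_apply, fourier_postcomp, fourier_partial, map_smul, matCLM_apply, Fin.sum_univ_three, smul_add, smul_smul]
    congr 4 <;> push_cast <;> ring_nf <;> simp
  simp only [h3]
  rw [dirac_symbol]
  simp only [partS, fourier_partial, norm_smul]
  rw [Fin.sum_univ_three, Fin.sum_univ_three]
  simp [mul_pow]
  nlinarith [sq_nonneg ‖𝓕 Ψ ξ‖]

section hardy

variable {F : Type*} [NormedAddCommGroup F] [InnerProductSpace ℝ F]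

/-- regularised vector field component -/
def wfun (a : Space) (ε : ℝ) (k : Fin 3) (x : Space) : ℝ := (x k - a k) * (‖x - a‖ ^ 2 + ε)⁻¹

def dwfun (a : Space) (ε : ℝ) (k : Fin 3) (x : Space) : ℝ :=
  (‖x - a‖ ^ 2 + ε)⁻¹ - 2 * (x k - a k) ^ 2 * ((‖x - a‖ ^ 2 + ε)⁻¹) ^ 2

theorem wfun_diff (a : Space) {ε : ℝ} (hε : 0 < ε) (k : Fin 3) (x : Space) :
    DifferentiableAt ℝ (wfun a ε k) x ∧
    fderiv ℝ (wfun a ε k) x (EuclideanSpace.single k 1) = dwfun a ε k x := by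
  have hq : ‖x - a‖ ^ 2 + ε ≠ 0 := by positivity
  have h1 : HasFDerivAt (fun x : Space => ‖x - a‖ ^ 2 + ε)
      (2 • (innerSL ℝ (x - a)).comp (ContinuousLinearMap.id ℝ Space)) x :=
    (((hasFDerivAt_id x).sub_const a).norm_sq).add_const ε
  have h2 : HasFDerivAt (fun x : Space => x k - a k) (EuclideanSpace.proj k : Space →L[ℝ] ℝ) x :=
    (EuclideanSpace.proj k : Space →L[ℝ] ℝ).hasFDerivAt.sub_const (a k)
  have h3 := h2.mul ((hasDerivAt_inv hq).comp_hasFDerivAt x h1)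
  have h4 : HasFDerivAt (wfun a ε k) _ x := h3
  refine ⟨h4.differentiableAt, ?_⟩
  rw [h4.fderiv]
  simp [dwfun, EuclideanSpace.inner_single_right]
  field_simp
  ring

theorem coord_le (v : Space) (k : Fin 3) : (v k) ^ 2 ≤ ‖v‖ ^ 2 := by
  have := PiLp.norm_apply_le v k
  rw [← sq_abs, ← Real.norm_eq_abs]
  gcongr

theorem wfun_bound (a : Space) {ε : ℝ} (hε : 0 < ε) (k : Fin 3) (x : Space) :
    |wfun a ε k x| ≤ 1 + 1 / ε ∧ |dwfun a ε k x| ≤ 3 / ε := by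
  have hc : (x k - a k) ^ 2 ≤ ‖x - a‖ ^ 2 := coord_le (x - a) k
  unfold wfun dwfun
  generalize ‖x - a‖ ^ 2 = r at *
  generalize x k - a k = t at *
  have hr : 0 ≤ r := (sq_nonneg t).trans hc
  have hq : 0 < r + ε := by positivity
  have h1 : (r + ε)⁻¹ ≤ 1 / ε := by
    rw [inv_eq_one_div]
    exact one_div_le_one_div_of_le hε (by linarith)
  have h1' : 0 < (r + ε)⁻¹ := inv_pos.2 hq
  have h2 : t ^ 2 * (r + ε)⁻¹ ≤ 1 := by
    rw [← div_eq_mul_inv, div_le_one hq]; linarith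
  constructor
  · rw [abs_mul, abs_of_pos h1']
    have : |t| ≤ t ^ 2 + 1 := by
      rw [← sq_abs]; nlinarith [sq_nonneg (|t| - 1), abs_nonneg t]
    nlinarith
  · have h3 : 3 / ε = 3 * (1 / ε) := by ring
    have h4 : 0 ≤ t ^ 2 * (r + ε)⁻¹ := by positivity
    have h5 : 2 * t ^ 2 * (r + ε)⁻¹ ^ 2 = 2 * (t ^ 2 * (r + ε)⁻¹) * (r + ε)⁻¹ := by ring
    rw [h5, h3, abs_le]
    constructor <;> nlinarith

theorem wfun_cont (a : Space) {ε : ℝ} (hε : 0 < ε) (k : Fin 3) :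
    Continuous (wfun a ε k) ∧ Continuous (dwfun a ε k) := by
  have : Continuous fun x : Space => (‖x - a‖ ^ 2 + ε)⁻¹ := by
    apply Continuous.inv₀ (by fun_prop)
    intro x
    positivity
  constructor
  · unfold wfun
    fun_prop
  · unfold dwfun
    fun_prop

theorem sq_int (f : 𝓢(Space, F)) : Integrable (fun x => ‖f x‖ ^ 2) := by
  have := (f.memLp 2 (volume : Measure Space))
  exact this.integrable_norm_pow (by norm_num)

theorem hardy_comp (f : 𝓢(Space, F)) (a : Space) {ε : ℝ} (hε : 0 < ε) (k : Fin 3) :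
    ∫ x, (dwfun a ε k x - wfun a ε k x ^ 2 / 2) * ‖f x‖ ^ 2 ≤
      2 * ∫ x, ‖fderiv ℝ f x (EuclideanSpace.single k 1)‖ ^ 2 := by
  set e : Space := EuclideanSpace.single k 1 with he
  have hw := wfun_bound a hε k
  obtain ⟨hwc, hdwc⟩ := wfun_cont a hε k
  have hf := sq_int f
  have hf' : Integrable fun x => ‖fderiv ℝ f x e‖ ^ 2 := sq_int (∂_{e} f)
  have hd : ∀ x, HasFDerivAt (fun x => ‖f x‖ ^ 2) (2 • (innerSL ℝ (f x)).comp (fderiv ℝ f x)) x :=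
    fun x => f.differentiableAt.hasFDerivAt.norm_sq
  have hd' : ∀ x, fderiv ℝ (fun x => ‖f x‖ ^ 2) x e = 2 * inner ℝ (f x) (fderiv ℝ f x e) := by
    intro x
    rw [(hd x).fderiv]
    simp
  have hin : Integrable fun x => 2 * inner ℝ (f x) (fderiv ℝ f x e) := by
    refine (hf.add hf').mono' ?_ (Filter.Eventually.of_forall fun x => ?_)
    · have : Continuous fun x => fderiv ℝ f x e := (∂_{e} f).continuous
      have := f.continuous
      exact Continuous.aestronglyMeasurable (by fun_prop)
    · have := abs_real_inner_le_norm (f x) (fderiv ℝ f x e)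
      simp only [Real.norm_eq_abs, abs_mul, abs_two, Pi.add_apply]
      nlinarith [sq_nonneg (‖f x‖ - ‖fderiv ℝ f x e‖)]
  have hI1 : Integrable fun x => dwfun a ε k x * ‖f x‖ ^ 2 :=
    hf.bdd_mul hdwc.aestronglyMeasurable (Filter.Eventually.of_forall fun x => (hw x).2)
  have hI2 : Integrable fun x => wfun a ε k x * (2 * inner ℝ (f x) (fderiv ℝ f x e)) :=
    hin.bdd_mul hwc.aestronglyMeasurable (Filter.Eventually.of_forall fun x => (hw x).1)
  have hI3 : Integrable fun x => wfun a ε k x * ‖f x‖ ^ 2 :=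
    hf.bdd_mul hwc.aestronglyMeasurable (Filter.Eventually.of_forall fun x => (hw x).1)
  have hI4 : Integrable fun x => wfun a ε k x * (wfun a ε k x * ‖f x‖ ^ 2) :=
    hI3.bdd_mul hwc.aestronglyMeasurable (Filter.Eventually.of_forall fun x => (hw x).1)
  have key := integral_mul_fderiv_eq_neg_fderiv_mul_of_integrable (μ := (volume : Measure Space))
    (f := wfun a ε k) (g := fun x => ‖f x‖ ^ 2) (v := e)
    (by simpa only [he, (wfun_diff a hε k _).2] using hI1) (by simpa only [hd'] using hI2) hI3
    (fun x _ => (wfun_diff a hε k x).1) (fun x _ => (hd x).differentiableAt)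
  simp only [hd'] at key
  simp only [he, (wfun_diff a hε k _).2] at key
  simp only [← he] at key
  have hle : ∫ x, -(wfun a ε k x * (2 * inner ℝ (f x) (fderiv ℝ f x e))) ≤
      ∫ x, (2 * ‖fderiv ℝ f x e‖ ^ 2 + 1 / 2 * (wfun a ε k x * (wfun a ε k x * ‖f x‖ ^ 2))) := by
    refine integral_mono hI2.neg ((hf'.const_mul 2).add (hI4.const_mul _)) fun x => ?_
    have h0 : 0 ≤ ‖fderiv ℝ f x e + (wfun a ε k x / 2) • f x‖ ^ 2 := sq_nonneg _
    rw [norm_add_sq_real, inner_smul_right, norm_smul, real_inner_comm, mul_pow, Real.norm_eq_abs,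
      sq_abs] at h0
    simp only []
    nlinarith
  rw [integral_neg, key, neg_neg, integral_add (hf'.const_mul 2) (hI4.const_mul _),
    integral_const_mul, integral_const_mul] at hle
  have : ∫ x, (dwfun a ε k x - wfun a ε k x ^ 2 / 2) * ‖f x‖ ^ 2 =
      ∫ x, dwfun a ε k x * ‖f x‖ ^ 2 - 1 / 2 * (wfun a ε k x * (wfun a ε k x * ‖f x‖ ^ 2)) := by
    congr 1; ext x; ring
  rw [this, integral_sub hI1 (hI4.const_mul _), integral_const_mul]
  linarith

theorem hardy_eps (f : 𝓢(Space, F)) (a : Space) {ε : ℝ} (hε : 0 < ε) :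
    Integrable (fun x => (‖x - a‖ ^ 2 + ε)⁻¹ * ‖f x‖ ^ 2) ∧
    ∫ x, (‖x - a‖ ^ 2 + ε)⁻¹ * ‖f x‖ ^ 2 ≤
      4 * ∑ k : Fin 3, ∫ x, ‖fderiv ℝ f x (EuclideanSpace.single k 1)‖ ^ 2 := by
  have hf := sq_int f
  have hc : Continuous fun x : Space => (‖x - a‖ ^ 2 + ε)⁻¹ := by
    apply Continuous.inv₀ (by fun_prop)
    intro x
    positivity
  have hI : Integrable (fun x => (‖x - a‖ ^ 2 + ε)⁻¹ * ‖f x‖ ^ 2) := by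
    refine hf.bdd_mul (c := ε⁻¹) hc.aestronglyMeasurable (Filter.Eventually.of_forall fun x => ?_)
    rw [Real.norm_eq_abs, abs_of_pos (by positivity)]
    exact inv_anti₀ hε (by nlinarith [sq_nonneg ‖x - a‖])
  refine ⟨hI, ?_⟩
  have hIk : ∀ k, Integrable fun x => (dwfun a ε k x - wfun a ε k x ^ 2 / 2) * ‖f x‖ ^ 2 := by
    intro k
    have hw := wfun_bound a hε k
    obtain ⟨hwc, hdwc⟩ := wfun_cont a hε k
    refine hf.bdd_mul (c := 3 / ε + (1 + 1 / ε) ^ 2 / 2) (by fun_prop)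
      (Filter.Eventually.of_forall fun x => ?_)
    refine (norm_sub_le _ _).trans (add_le_add (hw x).2 ?_)
    rw [Real.norm_eq_abs, abs_div, abs_pow, abs_two]
    gcongr
    exact (hw x).1
  have hs := Finset.sum_le_sum fun k (_ : k ∈ Finset.univ) => hardy_comp f a hε k
  rw [← integral_finsetSum _ (fun k _ => hIk k), ← Finset.mul_sum] at hs
  have h2 : ∫ x, 1 / 2 * ((‖x - a‖ ^ 2 + ε)⁻¹ * ‖f x‖ ^ 2) ≤
      ∫ x, ∑ k : Fin 3, (dwfun a ε k x - wfun a ε k x ^ 2 / 2) * ‖f x‖ ^ 2 := by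
    refine integral_mono (hI.const_mul _) (integrable_finsetSum _ fun k _ => hIk k) fun x => ?_
    simp only []
    rw [← Finset.sum_mul, ← mul_assoc]
    refine mul_le_mul_of_nonneg_right ?_ (sq_nonneg _)
    have hn : ‖x - a‖ ^ 2 = (x 0 - a 0) ^ 2 + (x 1 - a 1) ^ 2 + (x 2 - a 2) ^ 2 := by
      rw [EuclideanSpace.norm_sq_eq, Fin.sum_univ_three]
      simp
    have hr : 0 ≤ ‖x - a‖ ^ 2 := sq_nonneg _
    simp only [Fin.sum_univ_three, dwfun, wfun]
    rw [hn] at *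
    have hqi : ((x 0 - a 0) ^ 2 + (x 1 - a 1) ^ 2 + (x 2 - a 2) ^ 2 + ε) *
      ((x 0 - a 0) ^ 2 + (x 1 - a 1) ^ 2 + (x 2 - a 2) ^ 2 + ε)⁻¹ = 1 :=
      mul_inv_cancel₀ (by positivity)
    have hip : 0 < ((x 0 - a 0) ^ 2 + (x 1 - a 1) ^ 2 + (x 2 - a 2) ^ 2 + ε)⁻¹ := by positivity
    generalize ((x 0 - a 0) ^ 2 + (x 1 - a 1) ^ 2 + (x 2 - a 2) ^ 2 + ε)⁻¹ = i at *
    have h5 : ((x 0 - a 0) ^ 2 + (x 1 - a 1) ^ 2 + (x 2 - a 2) ^ 2) * i ^ 2 = i - ε * i ^ 2 := by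
      linear_combination i * hqi
    have h6 : 0 ≤ ε * i ^ 2 := by positivity
    nlinarith
  rw [integral_const_mul] at h2
  linarith

theorem hardy_lintegral (f : 𝓢(Space, F)) (a : Space) :
    ∫⁻ x, ENNReal.ofReal ((‖x - a‖⁻¹) ^ 2 * ‖f x‖ ^ 2) ≤
      ENNReal.ofReal (4 * ∑ k : Fin 3, ∫ x, ‖fderiv ℝ f x (EuclideanSpace.single k 1)‖ ^ 2) := by
  set C := 4 * ∑ k : Fin 3, ∫ x, ‖fderiv ℝ f x (EuclideanSpace.single k 1)‖ ^ 2
  let ε : ℕ → ℝ := fun n => 1 / ((n : ℝ) + 1)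
  have hε : ∀ n, 0 < ε n := fun n => Nat.one_div_pos_of_nat
  let g : ℕ → Space → ENNReal := fun n x => ENNReal.ofReal ((‖x - a‖ ^ 2 + ε n)⁻¹ * ‖f x‖ ^ 2)
  have hg : ∀ n, ∫⁻ x, g n x ≤ ENNReal.ofReal C := by
    intro n
    obtain ⟨h1, h2⟩ := hardy_eps f a (hε n)
    have := hε n
    rw [← ofReal_integral_eq_lintegral_ofReal h1 (Filter.Eventually.of_forall fun x => by positivity)]
    exact ENNReal.ofReal_le_ofReal h2
  have hgm : ∀ n, Measurable (g n) := by
    intro n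
    have := f.continuous.norm.measurable
    exact Measurable.ennreal_ofReal (by fun_prop)
  calc _ ≤ ∫⁻ x, Filter.liminf (fun n => g n x) Filter.atTop := by
        refine lintegral_mono fun x => ?_
        by_cases hx : x = a
        · simp [hx]
        · have hx' : ‖x - a‖ ^ 2 ≠ 0 := by
            have := sub_ne_zero.2 hx
            positivity
          have ht : Filter.Tendsto (fun n => g n x) Filter.atTop
              (nhds (ENNReal.ofReal ((‖x - a‖⁻¹) ^ 2 * ‖f x‖ ^ 2))) := by
            refine ENNReal.tendsto_ofReal (Filter.Tendsto.mul_const _ ?_)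
            rw [inv_pow]
            refine Filter.Tendsto.inv₀ ?_ hx'
            simpa [ε] using (tendsto_one_div_add_atTop_nhds_zero_nat (𝕜 := ℝ)).const_add (‖x - a‖ ^ 2)
          exact ht.liminf_eq.ge
    _ ≤ Filter.liminf (fun n => ∫⁻ x, g n x) Filter.atTop := lintegral_liminf_le hgm
    _ ≤ ENNReal.ofReal C := by
        refine (Filter.liminf_le_liminf (Filter.Eventually.of_forall hg)).trans ?_
        simp

end hardy

theorem hardy_spinor (f : 𝓢(Space, Spinor)) (a : Space) :
    ∫⁻ x, ENNReal.ofReal ((‖x - a‖⁻¹) ^ 2 * ‖f x‖ ^ 2) ≤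
      ENNReal.ofReal (4 * ∑ k : Fin 3, ∫ x, ‖partialDer f k x‖ ^ 2) :=
  @hardy_lintegral Spinor _ (InnerProductSpace.rclikeToReal ℂ Spinor) f a

theorem sqrt_eq_eLpNorm {f : Space → Spinor} (hf : MemLp f 2 (volume : Measure Space)) :
    Real.sqrt (∫ x, ‖f x‖ ^ 2) = (eLpNorm f 2 volume).toReal := by
  rw [hf.eLpNorm_eq_integral_rpow_norm (by norm_num) (by norm_num), ENNReal.toReal_ofReal (by positivity),
    Real.sqrt_eq_rpow]
  norm_num

theorem eLpNorm_two_sq (f : Space → Spinor) :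
    eLpNorm f 2 volume ^ 2 = ∫⁻ x, ‖f x‖ₑ ^ 2 := by
  rw [eLpNorm_eq_lintegral_rpow_enorm_toReal (by norm_num) (by norm_num), ← ENNReal.rpow_natCast,
    ← ENNReal.rpow_mul]
  norm_num

theorem lintegral_sq_le (μ : Measure Space) {h : Space → ENNReal} (hh : Measurable h) :
    (∫⁻ y, h y ∂μ) ^ 2 ≤ μ Set.univ * ∫⁻ y, h y ^ 2 ∂μ := by
  have := ENNReal.lintegral_mul_le_Lp_mul_Lq μ (Real.HolderConjugate.two_two) (f := fun _ => 1) (g := h)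
    aemeasurable_const hh.aemeasurable
  simp only [Pi.mul_apply, one_mul, ENNReal.one_rpow, lintegral_const] at this
  calc _ ≤ _ := pow_le_pow_left' this 2
    _ = _ := by
      rw [mul_pow, ← ENNReal.rpow_natCast, ← ENNReal.rpow_natCast, ← ENNReal.rpow_mul, ← ENNReal.rpow_mul]
      norm_num

theorem coulomb_enorm_le (ρ : SignedMeasure Space) (x : Space) :
    ‖coulombPotential ρ x‖ₑ ≤ ∫⁻ y, ENNReal.ofReal ‖x - y‖⁻¹ ∂ρ.totalVariation := by
  rw [SignedMeasure.totalVariation, lintegral_add_measure, coulombPotential]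
  refine enorm_sub_le.trans (add_le_add ?_ ?_) <;>
  · refine (enorm_integral_le_lintegral_enorm _).trans (lintegral_mono fun y => ?_)
    rw [Real.enorm_of_nonneg (by positivity)]

theorem coulomb_measurable (ρ : SignedMeasure Space) : StronglyMeasurable (coulombPotential ρ) := by
  have : StronglyMeasurable (Function.uncurry fun x y : Space => ‖x - y‖⁻¹) :=
    Measurable.stronglyMeasurable (by unfold Function.uncurry; fun_prop)
  unfold coulombPotential
  exact this.integral_prod_right.sub this.integral_prod_right

theorem coulomb_bound (ρ : SignedMeasure Space) (Ψ : 𝓢(Space, Spinor)) :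
    ∫⁻ x, ‖coulombPotential ρ x • Ψ x‖ₑ ^ 2 ≤
      ρ.totalVariation Set.univ ^ 2 *
        ENNReal.ofReal (4 * ∑ k : Fin 3, ∫ x, ‖partialDer Ψ k x‖ ^ 2) := by
  set C := ENNReal.ofReal (4 * ∑ k : Fin 3, ∫ x, ‖partialDer Ψ k x‖ ^ 2)
  set μ := ρ.totalVariation with hμ
  have : IsFiniteMeasure μ := by
    rw [hμ, SignedMeasure.totalVariation]; infer_instance
  have hΨ := Ψ.continuous.norm.measurable
  have hm : Measurable (Function.uncurry fun x y : Space =>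
      ENNReal.ofReal ((‖x - y‖⁻¹) ^ 2 * ‖Ψ x‖ ^ 2)) := by
    unfold Function.uncurry
    have : Measurable fun p : Space × Space => ‖Ψ p.1‖ := hΨ.comp measurable_fst
    fun_prop
  calc _ ≤ ∫⁻ x, μ Set.univ * ∫⁻ y, ENNReal.ofReal ((‖x - y‖⁻¹) ^ 2 * ‖Ψ x‖ ^ 2) ∂μ := by
        refine lintegral_mono fun x => ?_
        simp only []
        rw [enorm_smul, mul_pow]
        have h1 := (pow_le_pow_left' (coulomb_enorm_le ρ x) 2).trans
          (lintegral_sq_le ρ.totalVariation (h := fun y => ENNReal.ofReal ‖x - y‖⁻¹) (by fun_prop))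
        refine (mul_le_mul_left h1 _).trans ?_
        rw [mul_assoc, ← lintegral_mul_const _ (by fun_prop)]
        refine mul_le_mul_right (lintegral_mono fun y => ?_) _
        simp only []
        rw [ENNReal.ofReal_mul (by positivity), ENNReal.ofReal_pow (by positivity),
          ENNReal.ofReal_pow (by positivity), ofReal_norm]
    _ = μ Set.univ * ∫⁻ x, ∫⁻ y, ENNReal.ofReal ((‖x - y‖⁻¹) ^ 2 * ‖Ψ x‖ ^ 2) ∂μ :=
        lintegral_const_mul _ hm.lintegral_prod_right
    _ = μ Set.univ * ∫⁻ y, (∫⁻ x, ENNReal.ofReal ((‖x - y‖⁻¹) ^ 2 * ‖Ψ x‖ ^ 2)) ∂μ := by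
        rw [lintegral_lintegral_swap hm.aemeasurable]
    _ ≤ μ Set.univ * ∫⁻ y, C ∂μ :=
        mul_le_mul_right (lintegral_mono fun y => hardy_spinor Ψ y) _
    _ = _ := by
        rw [lintegral_const]; ring

/-- **Upper bound on `(D₀ + ρ∗|x|⁻¹)Ψ` (inequality `eq:upper_bd_D_Psi`).**
For every finite signed Borel measure `ρ` on `ℝ³` with total variation `|ρ|` and
every Schwartz function `Ψ : ℝ³ → ℂ⁴`,
`‖D₀Ψ + VΨ‖_{L²} ≤ (1 + 2|ρ|(ℝ³))·‖D₀Ψ‖_{L²}`, where `V = ρ ∗ ‖·‖⁻¹`. -/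
theorem dirac_coulomb_upper_bound
    (ρ : SignedMeasure Space) (Ψ : SchwartzMap Space Spinor) :
    Real.sqrt (∫ x, ‖diracOp Ψ x + coulombPotential ρ x • Ψ x‖ ^ 2) ≤
      (1 + 2 * (ρ.totalVariation Set.univ).toReal) *
        Real.sqrt (∫ x, ‖diracOp Ψ x‖ ^ 2) := by
  set V := coulombPotential ρ
  set M := ρ.totalVariation Set.univ with hM
  have hMfin : M ≠ ⊤ := by
    rw [hM, SignedMeasure.totalVariation]
    exact measure_ne_top _ _
  have hD : MemLp (diracOp Ψ) 2 (volume : Measure Space) := by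
    have : (diracOp Ψ) = ⇑(diracS Ψ) := by ext1 x; rw [diracS_apply]
    rw [this]
    exact (diracS Ψ).memLp 2 _
  have hDn := sqrt_eq_eLpNorm hD
  have hVm : AEStronglyMeasurable (fun x => V x • Ψ x) (volume : Measure Space) :=
    (coulomb_measurable ρ).aestronglyMeasurable.smul Ψ.continuous.aestronglyMeasurable
  have hVle : eLpNorm (fun x => V x • Ψ x) 2 (volume : Measure Space) ≤
      ENNReal.ofReal (2 * M.toReal * Real.sqrt (∫ x, ‖diracOp Ψ x‖ ^ 2)) := by
    rw [← ENNReal.pow_le_pow_left_iff (n := 2) (by norm_num), eLpNorm_two_sq]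
    refine (coulomb_bound ρ Ψ).trans ?_
    have hI : 0 ≤ ∫ x, ‖diracOp Ψ x‖ ^ 2 := integral_nonneg fun x => sq_nonneg _
    rw [← hM, ← ENNReal.ofReal_toReal hMfin, ← ENNReal.ofReal_pow ENNReal.toReal_nonneg,
      ← ENNReal.ofReal_mul (by positivity), ← ENNReal.ofReal_pow (by positivity),
      mul_pow, Real.sq_sqrt hI, ENNReal.toReal_ofReal ENNReal.toReal_nonneg]
    refine ENNReal.ofReal_le_ofReal ?_
    have := mul_le_mul_of_nonneg_left (grad_le_dirac Ψ) (sq_nonneg M.toReal)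
    nlinarith
  have hV : MemLp (fun x => V x • Ψ x) 2 (volume : Measure Space) :=
    ⟨hVm, hVle.trans_lt ENNReal.ofReal_lt_top⟩
  have hsum := sqrt_eq_eLpNorm (hD.add hV)
  simp only [Pi.add_apply] at hsum
  rw [hsum]
  have h1 := ENNReal.toReal_mono (ENNReal.add_ne_top.2 ⟨hD.2.ne, hV.2.ne⟩)
    (eLpNorm_add_le hD.1 hV.1 (p := 2) (by norm_num))
  rw [ENNReal.toReal_add hD.2.ne hV.2.ne, ← hDn] at h1
  have h2 := ENNReal.toReal_mono ENNReal.ofReal_ne_top hVle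
  rw [ENNReal.toReal_ofReal (by positivity)] at h2
  linarith
end
end
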